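/- (Wirtinger's inequality in minor form.) Let n, k be positive integers with k ≤ n and let L be a real 2n×2k matrix with columns X_1,…,X_{2k} ∈ ℝ^{2n}. For each subset S ⊆ {1,…,n} with |S| = k, let L_S denote the 2k×2k submatrix of L consisting of the rows with indices {2i−1, 2i : i ∈ S}, taken in increasing order. Then |Σ_{S ⊆ {1,…,n}, |S|=k} det(L_S)| ≤ √(det(Lᵀ L)); that is, the absolute value of (1/k!)ω^k(X_1,…,X_{2k}), the sum of the signed 2k-volume projections onto the symplectic 2k-planes, is at most the 2k-dimensional volume of the parallelepiped spanned by X_1,…,X_{2k}. -/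

import Mathlib

open Matrix

/-- The standard symplectic matrix `J` on `ℝ^{2m}`, with coordinates ordered in
symplectic pairs `(p₁,q₁,…,p_m,q_m)`. -/
def symplJ (m : ℕ) : Matrix (Fin (2 * m)) (Fin (2 * m)) ℝ :=
  Matrix.of fun i j =>
    if i.val + 1 = j.val ∧ i.val % 2 = 0 then (-1 : ℝ)
    else if j.val + 1 = i.val ∧ j.val % 2 = 0 then 1 else 0

/-- For a `k`-element subset `S ⊆ {1,…,n}`, the increasing enumeration of the
row indices `{2i−1, 2i : i ∈ S}` (0-indexed: `{2i, 2i+1 : i ∈ S}`) of the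
symplectic pairs of rows selected by `S`. -/
def symplRows {n : ℕ} (k : ℕ) (S : Finset (Fin n)) (hS : S.card = k) :
    Fin (2 * k) → Fin (2 * n) := fun a =>
  ⟨2 * (S.orderEmbOfFin hS ⟨a.val / 2, by omega⟩).val + a.val % 2, by
    have h := (S.orderEmbOfFin hS ⟨a.val / 2, by omega⟩).isLt
    omega⟩

/-- The sum over all `k`-element subsets `S ⊆ {1,…,n}` of the determinant of the
`2k × 2k` submatrix `L_S` of `L` consisting of the symplectic pairs of rows
indexed by `S`; this is `(1/k!)·ω^k` evaluated on the columns of `L`, i.e. the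
sum of the signed `2k`-volume projections of the parallelepiped spanned by the
columns of `L` onto the symplectic `2k`-planes. -/
noncomputable def symplMinorSum (n k : ℕ) (L : Matrix (Fin (2 * n)) (Fin (2 * k)) ℝ) : ℝ :=
  ∑ S : {S : Finset (Fin n) // S.card = k}, (L.submatrix (symplRows k S.1 S.2) id).det

section part1
variable {k n : ℕ}

abbrev WI (k : ℕ) := Fin k × Fin 2

def wM (R : Fin n → Fin 2 → WI k → ℝ) (s : Fin k → Fin n) : Matrix (WI k) (WI k) ℝ :=
  Matrix.of fun x c => R (s x.1) x.2 c

def wA (R : Fin n → Fin 2 → WI k → ℝ) : Matrix (WI k) (WI k) ℝ :=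
  Matrix.of fun a b => ∑ j, (R j 0 a * R j 1 b - R j 1 a * R j 0 b)

def wG (B : Matrix (WI k) (WI k) ℝ) : ℝ :=
  ∑ σ : Equiv.Perm (WI k), ((Equiv.Perm.sign σ : ℤ) : ℝ) * ∏ i, B (σ (i, 0)) (σ (i, 1))

lemma sum_wM_det (R : Fin n → Fin 2 → WI k → ℝ) :
    ∑ s, (wM R s).det = wG (Matrix.of fun a b => ∑ j, R j 0 a * R j 1 b) := by
  unfold wG
  simp_rw [← Matrix.det_transpose (wM R _), Matrix.det_apply']
  rw [Finset.sum_comm]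
  refine Finset.sum_congr rfl fun σ _ => ?_
  rw [← Finset.mul_sum]
  congr 1
  simp only [Matrix.of_apply]
  rw [Finset.prod_univ_sum]
  simp only [Fintype.piFinset_univ]
  refine Finset.sum_congr rfl fun s _ => ?_
  rw [Fintype.prod_prod_type]
  simp [wM]

lemma wG_skew (B : Matrix (WI k) (WI k) ℝ) :
    wG (Matrix.of fun a b => B a b - B b a) = 2 ^ k * wG B := by
  unfold wG
  have key : ∀ σ : Equiv.Perm (WI k), ∏ i, (B (σ (i, 0)) (σ (i, 1)) - B (σ (i, 1)) (σ (i, 0)))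
      = ∑ τ : Fin k → Equiv.Perm (Fin 2), (∏ i, ((Equiv.Perm.sign (τ i) : ℤ) : ℝ)) *
        ∏ i, B (σ (i, τ i 0)) (σ (i, τ i 1)) := by
    intro σ
    simp_rw [← Finset.prod_mul_distrib]
    rw [← Fintype.piFinset_univ, ← Finset.prod_univ_sum (fun _ => Finset.univ)
      (fun i (t : Equiv.Perm (Fin 2)) => ((Equiv.Perm.sign t : ℤ) : ℝ) *
        B (σ (i, t 0)) (σ (i, t 1)))]
    refine Finset.prod_congr rfl fun i _ => ?_
    have h2 : (Finset.univ : Finset (Equiv.Perm (Fin 2))) = {1, Equiv.swap 0 1} := by decide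
    rw [h2, Finset.sum_pair (by decide)]
    simp [sub_eq_add_neg]
  simp only [Matrix.of_apply]
  simp_rw [key, Finset.mul_sum]
  rw [Finset.sum_comm]
  have h3 : ∀ τ : Fin k → Equiv.Perm (Fin 2),
      (∑ σ : Equiv.Perm (WI k), ((Equiv.Perm.sign σ : ℤ) : ℝ) *
        ((∏ i, ((Equiv.Perm.sign (τ i) : ℤ) : ℝ)) * ∏ i, B (σ (i, τ i 0)) (σ (i, τ i 1)))) =
      ∑ σ : Equiv.Perm (WI k), ((Equiv.Perm.sign σ : ℤ) : ℝ) * ∏ i, B (σ (i, 0)) (σ (i, 1)) := by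
    intro τ
    refine Fintype.sum_equiv (Equiv.mulRight (Equiv.prodCongrRight τ : Equiv.Perm (WI k))) _ _ fun σ => ?_
    have : Equiv.Perm.sign (Equiv.prodCongrRight τ : Equiv.Perm (WI k)) = ∏ i, Equiv.Perm.sign (τ i) :=
      Equiv.Perm.sign_prodCongrRight τ
    simp [this, mul_assoc]
  rw [Finset.sum_congr rfl fun τ _ => h3 τ, Finset.sum_const, ← Finset.mul_sum]
  simp [Fintype.card_perm]

lemma sum_wM_det' (R : Fin n → Fin 2 → WI k → ℝ) :
    2 ^ k * ∑ s, (wM R s).det = wG (wA R) := by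
  rw [sum_wM_det, ← wG_skew]
  congr 1
  ext a b
  simp [wA, Finset.sum_sub_distrib, mul_comm]

lemma wM_perm (R : Fin n → Fin 2 → WI k → ℝ) (s : Fin k → Fin n) (τ : Equiv.Perm (Fin k)) :
    (wM R (s ∘ τ)).det = (wM R s).det := by
  have h : wM R (s ∘ τ) = (wM R s).submatrix (Equiv.prodCongrLeft fun _ : Fin 2 => τ : Equiv.Perm (WI k)) id := by
    ext x c; simp [wM, Equiv.prodCongrLeft]
  have : Equiv.Perm.sign (Equiv.prodCongrLeft (fun _ : Fin 2 => τ) : Equiv.Perm (WI k)) = ∏ i : Fin 2, Equiv.Perm.sign τ :=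
      Equiv.Perm.sign_prodCongrLeft _
  rw [h, Matrix.det_permute, this]
  simp

lemma wM_noninj (R : Fin n → Fin 2 → WI k → ℝ) (s : Fin k → Fin n) (hs : ¬ Function.Injective s) :
    (wM R s).det = 0 := by
  simp only [Function.Injective, not_forall] at hs
  obtain ⟨a, b, h, hab⟩ := hs
  refine Matrix.det_zero_of_row_eq (i := (a, 0)) (j := (b, 0)) (by simpa using hab) ?_
  ext c; simp [wM, h]

lemma sum_wM_subsets (R : Fin n → Fin 2 → WI k → ℝ) :
    ∑ s, (wM R s).det = (k.factorial : ℝ) *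
      ∑ S : {S : Finset (Fin n) // S.card = k}, (wM R (S.1.orderEmbOfFin S.2)).det := by
  classical
  rw [Finset.mul_sum]
  have e1 : ∑ s, (wM R s).det = ∑ s with Function.Injective s, (wM R s).det := by
    rw [Finset.sum_filter]
    refine Finset.sum_congr rfl fun s _ => ?_
    split_ifs with h
    · rfl
    · exact wM_noninj R s h
  have e2 : ∀ S : {S : Finset (Fin n) // S.card = k},
      (k.factorial : ℝ) * (wM R (S.1.orderEmbOfFin S.2)).det =
      ∑ τ : Equiv.Perm (Fin k), (wM R (S.1.orderEmbOfFin S.2 ∘ τ)).det := by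
    intro S
    simp [wM_perm, Fintype.card_perm]
  simp_rw [e2]
  rw [e1, ← Fintype.sum_prod_type']
  symm
  refine Finset.sum_bij (fun x _ => x.1.1.orderEmbOfFin x.1.2 ∘ x.2) ?_ ?_ ?_ ?_
  · intro x _
    simp only [Finset.mem_filter, Finset.mem_univ, true_and]
    exact (x.1.1.orderEmbOfFin x.1.2).injective.comp x.2.injective
  · rintro ⟨⟨S, hS⟩, σ⟩ _ ⟨⟨T, hT⟩, τ⟩ _ h
    simp only at h
    have hST : S = T := by
      have := congrArg Set.range h
      rw [σ.surjective.range_comp, τ.surjective.range_comp] at this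
      simpa using this
    subst hST
    have : σ = τ := by
      ext i
      have := congrFun h i
      simp only [Function.comp] at this
      rw [(S.orderEmbOfFin hS).injective this]
    rw [this]
  · intro s hs
    simp only [Finset.mem_filter, Finset.mem_univ, true_and] at hs
    have hc : (Finset.univ.image s).card = k := by
      rw [Finset.card_image_of_injective _ hs]; simp
    have hmem : ∀ i, ∃ j, (Finset.univ.image s).orderEmbOfFin hc j = s i := by
      intro i
      have : s i ∈ Set.range ((Finset.univ.image s).orderEmbOfFin hc) := by
        rw [Finset.range_orderEmbOfFin]; simp
      exact this
    choose g hg using hmem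
    have gi : Function.Injective g := by
      intro a b hab
      apply hs
      rw [← hg, ← hg, hab]
    refine ⟨(⟨_, hc⟩, Equiv.ofBijective g (Finite.injective_iff_bijective.mp gi)), by simp, ?_⟩
    ext i
    simp [hg]
  · intro x _
    rfl
end part1
section part2
lemma skew_decomp {I : Type*} [Fintype I] [DecidableEq I] (k : ℕ) : ∀ (A : Matrix I I ℝ) (T : Finset I),
    (∀ x y, A y x = - A x y) → (∀ x y, x ∉ T → A x y = 0) → T.card ≤ 2 * k →
    ∃ R : Fin k → Fin 2 → I → ℝ, ∀ a b, A a b = ∑ j, (R j 0 a * R j 1 b - R j 1 a * R j 0 b) := by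
  induction k with
  | zero =>
    intro A T hA hT hc
    have : T = ∅ := by simpa using hc
    subst this
    exact ⟨fun j => j.elim0, fun a b => by simp [hT]⟩
  | succ k ih =>
    intro A T hA hT hc
    by_cases h0 : ∀ a b, A a b = 0
    · exact ⟨fun _ _ _ => 0, fun a b => by simp [h0]⟩
    push Not at h0
    obtain ⟨a, b, hab⟩ := h0
    have hd : ∀ x, A x x = 0 := fun x => by linarith [hA x x]
    have hne : a ≠ b := by rintro rfl; exact hab (hd a)
    have haT : a ∈ T := by by_contra h; exact hab (hT a b h)
    have hbT : b ∈ T := by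
      by_contra h; apply hab; rw [hA b a, hT b a h, neg_zero]
    obtain ⟨R, hR⟩ := ih (Matrix.of fun x y => A x y - (A x b / A a b * A a y - A a x * (A y b / A a b)))
      ((T.erase a).erase b) (by intro x y; simp only [Matrix.of_apply]; rw [hA x y]; ring)
      (by
        intro x y hx
        simp only [Matrix.of_apply]
        by_cases hxb : x = b
        · subst hxb; rw [hd, hA y x]; field_simp; ring
        by_cases hxa : x = a
        · subst hxa; rw [hd]; field_simp; ring
        have hxT : x ∉ T := by simpa [hxa, hxb] using hx
        rw [hA x a, hT x y hxT, hT x b hxT, hT x a hxT]; simp)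
      (by
        rw [Finset.card_erase_of_mem (by simp [hbT, hne.symm]), Finset.card_erase_of_mem haT]; omega)
    refine ⟨Fin.cons ![fun x => A x b / A a b, fun x => A a x] R, fun x y => ?_⟩
    have := hR x y
    rw [Matrix.of_apply] at this
    rw [Fin.sum_univ_succ]
    simp only [Fin.cons_zero, Fin.cons_succ, Matrix.cons_val_zero, Matrix.cons_val_one]
    rw [← this]; ring
end part2

section part3
variable {I K : Type*} [Fintype I] [DecidableEq I] [Fintype K] [DecidableEq K]

lemma det_le_one_of_psd (M : Matrix I I ℝ) (hM : M.PosSemidef) (h1 : (1 - M).PosSemidef) :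
    M.det ≤ 1 := by
  rw [hM.1.det_eq_prod_eigenvalues]
  refine Finset.prod_le_one (fun i _ => hM.eigenvalues_nonneg i) fun i _ => ?_
  have h := h1.dotProduct_mulVec_nonneg (hM.1.eigenvectorBasis i).ofLp
  rw [Matrix.sub_mulVec, hM.1.mulVec_eigenvectorBasis, Matrix.one_mulVec, dotProduct_sub,
    dotProduct_smul] at h
  have h2 : star (hM.1.eigenvectorBasis i).ofLp ⬝ᵥ (hM.1.eigenvectorBasis i).ofLp = 1 := by
    have := (hM.1.eigenvectorBasis).orthonormal.1 i
    have h3 := real_inner_self_eq_norm_sq (hM.1.eigenvectorBasis i)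
    rw [this, EuclideanSpace.inner_eq_star_dotProduct] at h3
    rw [dotProduct_comm]
    simpa using h3
  rw [h2] at h
  simpa using h

open scoped MatrixOrder in
lemma exists_sqrt_mat (G : Matrix I I ℝ) (hG : G.PosSemidef) : ∃ S : Matrix I I ℝ, G = Sᵀ * S := by
  obtain ⟨S, hS⟩ := (CStarAlgebra.nonneg_iff_eq_star_mul_self (a := G)).mp hG.nonneg
  exact ⟨S, by simpa [Matrix.star_eq_conjTranspose] using hS⟩

lemma det_gram_le (X Y : Matrix K I ℝ) (h : Yᵀ * Y = Xᵀ * X) :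
    (Xᵀ * Y).det ≤ (Xᵀ * X).det := by
  have hG : (Xᵀ * X).PosSemidef := by
    simpa using Matrix.posSemidef_conjTranspose_mul_self X
  obtain ⟨S, hS⟩ := exists_sqrt_mat _ hG
  by_cases hd : S.det = 0
  · have hd0 : (Xᵀ * X).det = 0 := by rw [hS]; simp [hd]
    obtain ⟨v, hv, hv0⟩ := Matrix.exists_mulVec_eq_zero_iff.mpr hd0
    have hY : (Yᵀ * Y) *ᵥ v = 0 := by rw [h, hv0]
    have hY' : Y *ᵥ v = 0 := by
      have : v ∈ LinearMap.ker (Yᵀ * Y).mulVecLin := by rw [LinearMap.mem_ker, Matrix.mulVecLin_apply]; exact hY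
      rw [Matrix.ker_mulVecLin_transpose_mul_self] at this
      simpa using this
    have : (Xᵀ * Y).det = 0 := Matrix.exists_mulVec_eq_zero_iff.mp
      ⟨v, hv, by rw [← Matrix.mulVec_mulVec, hY', Matrix.mulVec_zero]⟩
    rw [this, hd0]
  have hu : IsUnit S.det := isUnit_iff_ne_zero.mpr hd
  have e1 : S * S⁻¹ = 1 := Matrix.mul_nonsing_inv S hu
  have e2 : S⁻¹ * S = 1 := Matrix.nonsing_inv_mul S hu
  have e3 : S⁻¹ᵀ * Sᵀ = 1 := by rw [← Matrix.transpose_mul, e1, Matrix.transpose_one]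
  have e4 : Sᵀ * S⁻¹ᵀ = 1 := by rw [← Matrix.transpose_mul, e2, Matrix.transpose_one]
  obtain ⟨U, hU⟩ : ∃ U, U = X * S⁻¹ := ⟨_, rfl⟩
  obtain ⟨V, hV⟩ : ∃ V, V = Y * S⁻¹ := ⟨_, rfl⟩
  have hX : X = U * S := by rw [hU, Matrix.mul_assoc, e2, Matrix.mul_one]
  have hY : Y = V * S := by rw [hV, Matrix.mul_assoc, e2, Matrix.mul_one]
  have hUU : Uᵀ * U = 1 := by
    calc Uᵀ * U = S⁻¹ᵀ * (Xᵀ * X) * S⁻¹ := by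
          rw [hU, Matrix.transpose_mul]; simp only [Matrix.mul_assoc]
      _ = (S⁻¹ᵀ * Sᵀ) * (S * S⁻¹) := by rw [hS]; simp only [Matrix.mul_assoc]
      _ = 1 := by rw [e1, e3, Matrix.mul_one]
  have hVV : Vᵀ * V = 1 := by
    calc Vᵀ * V = S⁻¹ᵀ * (Yᵀ * Y) * S⁻¹ := by
          rw [hV, Matrix.transpose_mul]; simp only [Matrix.mul_assoc]
      _ = (S⁻¹ᵀ * Sᵀ) * (S * S⁻¹) := by rw [h, hS]; simp only [Matrix.mul_assoc]
      _ = 1 := by rw [e1, e3, Matrix.mul_one]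
  have hC : ((Uᵀ * V)ᵀ * (Uᵀ * V)).det ≤ 1 := by
    apply det_le_one_of_psd
    · simpa using Matrix.posSemidef_conjTranspose_mul_self (Uᵀ * V)
    · have : 1 - (Uᵀ * V)ᵀ * (Uᵀ * V) = (V - U * (Uᵀ * V))ᵀ * (V - U * (Uᵀ * V)) := by
        have h5 : Vᵀ * U * Uᵀ * U * Uᵀ * V = Vᵀ * U * Uᵀ * V := by
          calc Vᵀ * U * Uᵀ * U * Uᵀ * V = Vᵀ * U * (Uᵀ * U) * Uᵀ * V := by
                simp only [Matrix.mul_assoc]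
            _ = _ := by rw [hUU, Matrix.mul_one]
        simp only [Matrix.transpose_sub, Matrix.transpose_mul, Matrix.transpose_transpose,
          Matrix.sub_mul, Matrix.mul_sub, hVV, ← Matrix.mul_assoc, h5]
        abel
      rw [this]
      simpa using Matrix.posSemidef_conjTranspose_mul_self (V - U * (Uᵀ * V))
  have hC1 : (Uᵀ * V).det ≤ 1 := by
    rw [Matrix.det_mul, Matrix.det_transpose] at hC
    nlinarith
  have hA : (Xᵀ * Y).det = S.det ^ 2 * (Uᵀ * V).det := by
    have : Xᵀ * Y = Sᵀ * (Uᵀ * V) * S := by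
      rw [hX, hY, Matrix.transpose_mul]; simp only [Matrix.mul_assoc]
    rw [this, Matrix.det_mul, Matrix.det_mul, Matrix.det_transpose]; ring
  rw [hA, hS, Matrix.det_mul, Matrix.det_transpose]
  nlinarith [sq_nonneg S.det]
end part3

section part4
variable {k n : ℕ}

lemma wSum_eq (R : Fin n → Fin 2 → WI k → ℝ) :
    2 ^ k * ((k.factorial : ℝ) *
      ∑ S : {S : Finset (Fin n) // S.card = k}, (wM R (S.1.orderEmbOfFin S.2)).det) = wG (wA R) := by
  rw [← sum_wM_subsets, sum_wM_det']

lemma wSum_self (R : Fin k → Fin 2 → WI k → ℝ) :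
    ∑ S : {S : Finset (Fin k) // S.card = k}, (wM R (S.1.orderEmbOfFin S.2)).det
      = (wM R id).det := by
  have hc : (Finset.univ : Finset (Fin k)).card = k := by simp
  rw [Fintype.sum_eq_single ⟨Finset.univ, hc⟩]
  · congr 2
    exact (Finset.orderEmbOfFin_unique hc (fun x => Finset.mem_univ _) strictMono_id).symm
  · rintro ⟨S, hS⟩ h
    exact absurd (Subtype.ext ((Finset.card_eq_iff_eq_univ S).mp (by simpa using hS))) h

/-- rows with pairs swapped and one sign -/
def wY (R : Fin n → Fin 2 → WI k → ℝ) : Matrix (Fin n × Fin 2) (WI k) ℝ :=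
  Matrix.of fun x c => if x.2 = 0 then R x.1 1 c else - R x.1 0 c
def wX (R : Fin n → Fin 2 → WI k → ℝ) : Matrix (Fin n × Fin 2) (WI k) ℝ :=
  Matrix.of fun x c => R x.1 x.2 c

lemma wXY (R : Fin n → Fin 2 → WI k → ℝ) : (wX R)ᵀ * wY R = wA R := by
  ext a b
  simp [Matrix.mul_apply, wX, wY, wA, Fintype.sum_prod_type, sub_eq_add_neg]

lemma wYY (R : Fin n → Fin 2 → WI k → ℝ) : (wY R)ᵀ * wY R = (wX R)ᵀ * wX R := by
  ext a b
  simp [Matrix.mul_apply, wX, wY, Fintype.sum_prod_type, add_comm]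

/-- The square of the sum of minors is the determinant of the skew form. -/
lemma wSum_sq (R : Fin n → Fin 2 → WI k → ℝ) :
    (∑ S : {S : Finset (Fin n) // S.card = k}, (wM R (S.1.orderEmbOfFin S.2)).det) ^ 2
      = (wA R).det := by
  obtain ⟨N, hN⟩ := skew_decomp k (wA R) Finset.univ
    (by
      intro x y
      simp only [wA, Matrix.of_apply, ← Finset.sum_neg_distrib]
      exact Finset.sum_congr rfl fun j _ => by ring)
    (by simp) (by simp [mul_comm])
  have hA : wA R = wA N := by ext a b; rw [hN]; rfl
  have hs := wSum_eq R
  rw [hA, ← wSum_eq N, wSum_self] at hs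
  have h1 : (2 : ℝ) ^ k ≠ 0 := by positivity
  have h2 : (k.factorial : ℝ) ≠ 0 := by positivity
  rw [mul_left_cancel₀ h2 (mul_left_cancel₀ h1 hs), hA, ← wXY]
  have hX : wM N id = wX N := by ext x c; simp [wM, wX]
  rw [Matrix.det_mul, Matrix.det_transpose, hX]
  have hYd : (wY N).det = (wX N).det := by
    have : wY N = (Matrix.blockDiagonal (fun _ : Fin k => (!![0, 1; -1, 0] : Matrix (Fin 2) (Fin 2) ℝ))).submatrix
        Prod.swap Prod.swap * wX N := by
      ext ⟨i, e⟩ c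
      rw [Matrix.mul_apply, Fintype.sum_prod_type]
      fin_cases e <;> simp [wY, wX, Matrix.blockDiagonal_apply]
    rw [this, Matrix.det_mul]
    have := Matrix.det_submatrix_equiv_self (Equiv.prodComm (Fin k) (Fin 2))
      (Matrix.blockDiagonal (fun _ : Fin k => (!![0, 1; -1, 0] : Matrix (Fin 2) (Fin 2) ℝ)))
    rw [Equiv.coe_prodComm] at this
    rw [this, Matrix.det_blockDiagonal]
    simp [Matrix.det_fin_two]
  rw [hYd, sq]

def wE (k : ℕ) : WI k ≃ Fin (2 * k) where
  toFun x := ⟨2 * x.1.val + x.2.val, by omega⟩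
  invFun a := (⟨a.val / 2, by omega⟩, ⟨a.val % 2, by omega⟩)
  left_inv x := by
    obtain ⟨⟨i, hi⟩, ⟨e, he⟩⟩ := x
    simp only [Prod.mk.injEq, Fin.mk.injEq]; omega
  right_inv a := by ext; simp only; omega
end part4

/-- **Wirtinger's inequality in minor form.**  For a real `2n × 2k` matrix `L`
(`0 < k ≤ n`), the absolute value of the sum of the signed `2k`-volume
projections of the parallelepiped spanned by the columns of `L` onto the
symplectic `2k`-planes is at most its `2k`-dimensional volume `√det(LᵀL)`. -/
theorem abs_symplMinorSum_le_volume (n k : ℕ) (hk : 0 < k) (hkn : k ≤ n)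
    (L : Matrix (Fin (2 * n)) (Fin (2 * k)) ℝ) :
    |symplMinorSum n k L| ≤ Real.sqrt (Lᵀ * L).det := by
  set R : Fin n → Fin 2 → WI k → ℝ := fun j e c => L (wE n (j, e)) (wE k c) with hR
  have h1 : symplMinorSum n k L =
      ∑ S : {S : Finset (Fin n) // S.card = k}, (wM R (S.1.orderEmbOfFin S.2)).det := by
    unfold symplMinorSum
    refine Finset.sum_congr rfl fun S _ => ?_
    rw [← Matrix.det_submatrix_equiv_self (wE k)]
    congr 1
    ext x c
    obtain ⟨⟨i, hi⟩, ⟨e, he⟩⟩ := x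
    simp only [Matrix.submatrix_apply, wM, Matrix.of_apply, hR, id]
    congr 1
    ext
    have ha : (2 * i + e) / 2 = i := by omega
    have hb : (2 * i + e) % 2 = e := by omega
    simp only [symplRows, wE, Equiv.coe_fn_mk, ha, hb]
  have hX : wX R = L.submatrix (wE n) (wE k) := by
    ext x c; rfl
  have h2 : (Lᵀ * L).det = ((wX R)ᵀ * wX R).det := by
    rw [← Matrix.det_submatrix_equiv_self (wE k), hX, Matrix.transpose_submatrix,
      Matrix.submatrix_mul_equiv]
  apply Real.abs_le_sqrt
  rw [h1, wSum_sq, h2, ← wXY]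
  exact det_gram_le _ _ (wYY R)
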